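/- Let R ⊊ E_n be a proper subset (the parabolic type) and write E_n ∖ R = {r_1, …, r_h} with h = n − |R|, numbered so that r_{i+1} is the element of E_n ∖ R following r_i (subscripts of r read modulo h, so r_0 = r_h and r_{h+1} = r_1). For 1 ≤ i ≤ h let g_i ≥ 1 be the least positive integer with r_{i−1} + g_i ≡ r_i (mod n). Define λ_k^{(i)} = e_{r_i} + p^k e_{r_i − k} for 1 ≤ k ≤ g_i − 1 and λ_{g_i}^{(i)} = e_{r_i} − p^{g_i} e_{r_{i−1}}, giving n = Σ_{i=1}^h g_i vectors in ℤ^n. Let D = {x ∈ ℤ^n : F_R^{(d)}(x) ≤ 0 for all d ∈ E_n, and x_j ≥ 0 for all j ∈ R}. Then every λ_k^{(i)} lies in D, and every element of D is a ℚ_{≥0}-linear combination of the vectors λ_k^{(i)} (1 ≤ i ≤ h, 1 ≤ k ≤ g_i). -/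

import Mathlib

open scoped Pointwise

/-- The sign `δ_A^{(i)}`: `-1` if `i ∈ A`, `1` otherwise. -/
def sgn {n : ℕ} (A : Finset (ZMod n)) (i : ZMod n) : ℤ := if i ∈ A then -1 else 1

/-- The `p`-expression `F_T^{(d)}(x) = Σ_{i=0}^{n−1} p^i δ_T^{(d+i)} x_{d+i}`. -/
def pExpr (p : ℕ) {n : ℕ} (T : Finset (ZMod n)) (d : ZMod n) (x : ZMod n → ℤ) : ℤ :=
  ∑ i ∈ Finset.range n, (p : ℤ) ^ i * sgn T (d + (i : ZMod n)) * x (d + (i : ZMod n))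

/-- The `S`-adapted `p`-cone associated to `γ`. -/
def adapCone (p : ℕ) {n : ℕ} (S : Finset (ZMod n)) (γ : ZMod n → Finset (ZMod n)) :
    Set (ZMod n → ℤ) :=
  {x | ∀ i ∈ S, pExpr p (γ i) i x ≤ 0}

/-- The vector `ha_{R,S}^{(i)}`. -/
def haVec (p : ℕ) {n : ℕ} (R S : Finset (ZMod n)) (i : ZMod n) : ZMod n → ℤ :=
  (if i ∈ S then (1 : ℤ) else -1) • Pi.single i (1 : ℤ)
    - ((p : ℤ) * sgn R (i - 1)) • Pi.single (i - 1) (1 : ℤ)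

/-- Saturation of a subset of `ℤ^n`. -/
def satur {n : ℕ} (C : Set (ZMod n → ℤ)) : Set (ZMod n → ℤ) :=
  {x | ∃ m : ℕ, 1 ≤ m ∧ (m : ℤ) • x ∈ C}

/-- The cone of partial Hasse invariants `𝒞_{pHa,S}`. -/
def CpHa (p : ℕ) {n : ℕ} [NeZero n] (R S : Finset (ZMod n)) : Set (ZMod n → ℤ) :=
  satur {x | ∃ c : ZMod n → ℤ, (∀ i ∈ S, 0 ≤ c i) ∧ x = ∑ i, c i • haVec p R S i}

/-- The kernel `𝕂_{R,S}`. -/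
def haKer (p : ℕ) {n : ℕ} [NeZero n] (R S : Finset (ZMod n)) : Set (ZMod n → ℤ) :=
  satur {x | ∃ c : ZMod n → ℤ, (∀ i ∈ S, c i = 0) ∧ x = ∑ i, c i • haVec p R S i}

/-- `T` is admissible with respect to `R` and `S`. -/
def Admissible {n : ℕ} (R S T : Finset (ZMod n)) : Prop :=
  ∀ i : ZMod n, i + 1 ∉ S →
    if i ∈ R then (i ∈ T ↔ i + 1 ∈ T) else (i ∈ T ↔ i + 1 ∉ T)

/-- `T` is `i`-positive. -/
def IPositive {n : ℕ} (R T : Finset (ZMod n)) (i : ZMod n) : Prop :=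
  i - 1 ∈ T ↔ i - 1 ∈ R
/-- The vector `λ_k^{(i)}` over `ℤ`: `e_{r_i} + p^k e_{r_i−k}` for `1 ≤ k < g_i`, and
`e_{r_i} − p^{g_i} e_{r_{i−1}}` for `k = g_i`. -/
def lamVecZ (p : ℕ) {n h : ℕ} [NeZero h] (rr : Fin h → ZMod n) (g : Fin h → ℕ)
    (i : Fin h) (k : ℕ) : ZMod n → ℤ :=
  if k = g i then Pi.single (rr i) (1 : ℤ) - (p : ℤ) ^ (g i) • Pi.single (rr (i - 1)) (1 : ℤ)
  else Pi.single (rr i) (1 : ℤ) + (p : ℤ) ^ k • Pi.single (rr i - (k : ZMod n)) (1 : ℤ)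

/-- The vector `λ_k^{(i)}` over `ℚ`. -/
def lamVecQ (p : ℕ) {n h : ℕ} [NeZero h] (rr : Fin h → ZMod n) (g : Fin h → ℕ)
    (i : Fin h) (k : ℕ) : ZMod n → ℚ :=
  if k = g i then
    Pi.single (rr i) (1 : ℚ) - (p : ℚ) ^ (g i) • (Pi.single (rr (i - 1)) (1 : ℚ) : ZMod n → ℚ)
  else
    Pi.single (rr i) (1 : ℚ) + (p : ℚ) ^ k • (Pi.single (rr i - (k : ZMod n)) (1 : ℚ) : ZMod n → ℚ)

/-- The cone `D = 𝒞_{E_n} ∩ X^*_{+,L}(T)`: the set of `x ∈ ℤ^n` with `F_R^{(d)}(x) ≤ 0`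
for all `d ∈ E_n` and `x_j ≥ 0` for all `j ∈ R`. -/
def Dcone (p : ℕ) {n : ℕ} (R : Finset (ZMod n)) : Set (ZMod n → ℤ) :=
  {x | (∀ d : ZMod n, pExpr p R d x ≤ 0) ∧ ∀ j ∈ R, 0 ≤ x j}

lemma pExpr_add (p : ℕ) {n : ℕ} (T : Finset (ZMod n)) (d : ZMod n) (x y : ZMod n → ℤ) :
    pExpr p T d (x + y) = pExpr p T d x + pExpr p T d y := by
  simp [pExpr, mul_add, Finset.sum_add_distrib]

lemma pExpr_smul (p : ℕ) {n : ℕ} (T : Finset (ZMod n)) (d : ZMod n) (c : ℤ) (x : ZMod n → ℤ) :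
    pExpr p T d (c • x) = c * pExpr p T d x := by
  simp [pExpr, Finset.mul_sum, mul_left_comm]

lemma pExpr_single (p : ℕ) {n : ℕ} [NeZero n] (T : Finset (ZMod n)) (d a : ZMod n) :
    pExpr p T d (Pi.single a 1) = (p : ℤ) ^ (a - d).val * sgn T a := by
  unfold pExpr
  rw [Finset.sum_eq_single (a - d).val]
  · simp
  · intro b hb hne
    have : d + (b : ZMod n) ≠ a := by
      rintro rfl
      apply hne
      rw [add_sub_cancel_left, ZMod.val_natCast, Nat.mod_eq_of_lt (Finset.mem_range.1 hb)]
    simp [Pi.single_eq_of_ne this]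
  · intro hmem
    exact absurd (Finset.mem_range.2 (ZMod.val_lt _)) hmem

/-- Moving the starting index of a `p`-expression one step forward. -/
lemma pExpr_eq_add_succ (p : ℕ) {n : ℕ} (T : Finset (ZMod n)) (d : ZMod n) (x : ZMod n → ℤ) :
    pExpr p T d x = (1 - (p : ℤ) ^ n) * (sgn T d * x d) + p * pExpr p T (d + 1) x := by
  have hsucc := Finset.sum_range_succ
    (fun i : ℕ => (p : ℤ) ^ i * sgn T (d + (i : ZMod n)) * x (d + (i : ZMod n))) n
  rw [Finset.sum_range_succ'] at hsucc
  have hshift : (p : ℤ) * pExpr p T (d + 1) x = ∑ i ∈ Finset.range n,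
      (p : ℤ) ^ (i + 1) * sgn T (d + ((i + 1 : ℕ) : ZMod n)) * x (d + ((i + 1 : ℕ) : ZMod n)) := by
    rw [pExpr, Finset.mul_sum]
    refine Finset.sum_congr rfl fun i _ => ?_
    rw [show d + ((i + 1 : ℕ) : ZMod n) = d + 1 + i by push_cast; ring]
    ring
  simp only [← hshift, Nat.cast_zero, add_zero, pow_zero, CharP.cast_eq_zero] at hsucc
  change _ = pExpr p T d x + _ at hsucc
  linarith

lemma val_sub_le_val_sub_add {n : ℕ} [NeZero n] {a b : ZMod n} (d : ZMod n) {k : ℕ}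
    (hab : b + k = a) : (a - d).val ≤ (b - d).val + k := by
  have : a - d = (((b - d).val + k : ℕ) : ZMod n) := by
    push_cast
    rw [ZMod.natCast_zmod_val, ← hab]
    ring
  rw [this, ZMod.val_natCast]
  exact Nat.mod_le _ _

lemma pExpr_single_add_nonpos {p : ℕ} (hp : 0 < p) {n : ℕ} [NeZero n] {T : Finset (ZMod n)}
    {a b : ZMod n} {k : ℕ} (hab : b + k = a) (ha : a ∉ T) (d : ZMod n) :
    pExpr p T d (Pi.single a 1 - (p ^ k * sgn T b : ℤ) • Pi.single b 1) ≤ 0 := by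
  have hb : sgn T b * sgn T b = 1 := by unfold sgn; split_ifs <;> rfl
  have hsa : sgn T a = 1 := if_neg ha
  have hle : (p : ℤ) ^ (a - d).val ≤ (p : ℤ) ^ ((b - d).val + k) :=
    pow_le_pow_right₀ (by exact_mod_cast hp) (val_sub_le_val_sub_add d hab)
  rw [sub_eq_add_neg, ← neg_smul, pExpr_add, pExpr_smul, pExpr_single, pExpr_single, hsa]
  calc _ = (p : ℤ) ^ (a - d).val - (p : ℤ) ^ ((b - d).val + k) * (sgn T b * sgn T b) := by ring
    _ ≤ 0 := by rw [hb]; linarith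

/-- Splitting a sum over `ℤ/n` into blocks ending at the elements outside `R`. -/
lemma sum_blocks {n h : ℕ} [NeZero n] [NeZero h] {R : Finset (ZMod n)}
    {rr : Fin h → ZMod n} {g : Fin h → ℕ} (hinj : Function.Injective rr)
    (hrr : Finset.image rr Finset.univ = Rᶜ) (hg1 : ∀ i, 1 ≤ g i)
    (hgap : ∀ i, rr (i - 1) + (g i : ZMod n) = rr i)
    (hmem : ∀ i, ∀ k : ℕ, 1 ≤ k → k < g i → rr i - (k : ZMod n) ∈ R)
    {M : Type*} [AddCommMonoid M] (f : ZMod n → M) :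
    ∑ i, ∑ k ∈ Finset.range (g i), f (rr i - (k : ZMod n)) = ∑ j, f j := by
  have hnot : ∀ i, rr i ∉ R := fun i =>
    Finset.mem_compl.1 (hrr ▸ Finset.mem_image_of_mem rr (Finset.mem_univ i))
  have hlt : ∀ i i' : Fin h, ∀ k k' : ℕ, k' < g i' → k < k' →
      rr i - (k : ZMod n) ≠ rr i' - (k' : ZMod n) := by
    intro i i' k k' hk' hkk heq
    apply hnot i
    have := hmem i' (k' - k) (by omega) (by omega)
    rw [Nat.cast_sub hkk.le] at this
    convert this using 1
    linear_combination heq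
  rw [Finset.sum_sigma']
  refine Finset.sum_bij (fun s _ => rr s.1 - (s.2 : ZMod n)) (fun _ _ => Finset.mem_univ _)
    ?_ ?_ (fun _ _ => rfl)
  · rintro ⟨i, k⟩ hs ⟨i', k'⟩ hs' heq
    simp only [Finset.mem_sigma, Finset.mem_univ, Finset.mem_range, true_and] at hs hs' heq
    obtain hk | rfl | hk := lt_trichotomy k k'
    · exact absurd heq (hlt i i' k k' hs' hk)
    · rw [hinj (sub_left_injective heq)]
    · exact absurd heq.symm (hlt i' i k' k hs hk)
  · intro j _
    have hex : ∃ t : ℕ, j + (t : ZMod n) ∉ R :=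
      ⟨(rr 0 - j).val, by rw [ZMod.natCast_zmod_val, add_sub_cancel]; exact hnot 0⟩
    obtain ⟨i, -, hi⟩ := Finset.mem_image.1 (hrr ▸ Finset.mem_compl.2 (Nat.find_spec hex))
    refine ⟨⟨i, Nat.find hex⟩, ?_, by simp [hi]⟩
    simp only [Finset.mem_sigma, Finset.mem_univ, Finset.mem_range, true_and]
    by_contra! hle
    refine Nat.find_min hex (m := Nat.find hex - g i) (by have := hg1 i; omega) ?_
    convert hnot (i - 1) using 2
    rw [Nat.cast_sub hle]
    linear_combination -hgap i - hi

lemma sum_div_pow_telescope {n : ℕ} {q : ℚ} (hq : q ≠ 0) {x C : ZMod n → ℚ} {a : ZMod n}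
    (m : ℕ) (hC : ∀ k : ℕ, 1 ≤ k → k ≤ m →
      C (a - k) = -x (a - k) + q * C (a - k + 1)) :
    ∑ k ∈ Finset.range m, x (a - ((k + 1 : ℕ) : ZMod n)) / q ^ (k + 1) + C (a - m) / q ^ m
      = C a := by
  induction m with
  | zero => simp
  | succ m ih =>
    rw [← ih fun k h1 h2 => hC k h1 (by omega), Finset.sum_range_succ, add_assoc]
    congr 1
    rw [hC (m + 1) (by omega) le_rfl,
      show a - ((m + 1 : ℕ) : ZMod n) + 1 = a - m by push_cast; ring]
    field_simp
    ring

/-- Proposition 5.13: the vectors `λ_k^{(i)}` (`1 ≤ i ≤ h`, `1 ≤ k ≤ g_i`) all lie in the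
cone `D = {x ∈ ℤ^n : F_R^{(d)}(x) ≤ 0 ∀ d, x_j ≥ 0 ∀ j ∈ R}`, and every element of `D` is a
`ℚ_{≥0}`-linear combination of them. Here `r_1, …, r_h` enumerates `E_n ∖ R` so that
`r_i` is the element of `E_n ∖ R` following `r_{i−1}` (subscripts mod `h`), and `g_i ≥ 1`
is minimal with `r_{i−1} + g_i ≡ r_i (mod n)`. -/
theorem Dcone_generators (p : ℕ) (hp : p.Prime) {n : ℕ} [NeZero n]
    (R : Finset (ZMod n)) (hR : R ≠ Finset.univ)
    (h : ℕ) [NeZero h] (hh : h = n - R.card)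
    (rr : Fin h → ZMod n) (hrr : Finset.image rr Finset.univ = Rᶜ)
    (g : Fin h → ℕ) (hg1 : ∀ i, 1 ≤ g i)
    (hgap : ∀ i : Fin h, rr (i - 1) + (g i : ZMod n) = rr i)
    (hleast : ∀ i : Fin h, ∀ u : ℕ, 1 ≤ u → u < g i → rr (i - 1) + (u : ZMod n) ≠ rr i)
    (hfollow : ∀ i : Fin h, ∀ u : ℕ, 1 ≤ u → u < g i → rr (i - 1) + (u : ZMod n) ∈ R) :
    (∀ i : Fin h, ∀ k ∈ Finset.Icc 1 (g i), lamVecZ p rr g i k ∈ Dcone p R) ∧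
    (∀ x ∈ Dcone p R, ∃ c : Fin h → ℕ → ℚ,
      (∀ i k, 0 ≤ c i k) ∧
      (fun j => ((x j : ℚ))) =
        ∑ i : Fin h, ∑ k ∈ Finset.Icc 1 (g i), c i k • lamVecQ p rr g i k) := by
  have hinj : Function.Injective rr := by
    rw [← Set.injOn_univ, ← Finset.coe_univ, ← Finset.card_image_iff, hrr,
      Finset.card_compl, ZMod.card, ← hh, Finset.card_univ, Fintype.card_fin]
  have hnot : ∀ i, rr i ∉ R := fun i =>
    Finset.mem_compl.1 (hrr ▸ Finset.mem_image_of_mem rr (Finset.mem_univ i))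
  have hmem : ∀ i, ∀ k : ℕ, 1 ≤ k → k < g i → rr i - (k : ZMod n) ∈ R := by
    intro i k h1 h2
    have := hfollow i (g i - k) (by omega) (by omega)
    rwa [Nat.cast_sub h2.le, ← add_sub_assoc, hgap] at this
  refine ⟨fun i k hk => ?_, fun x hx => ?_⟩
  · rw [Finset.mem_Icc] at hk
    obtain rfl | hne := eq_or_ne k (g i)
    · rw [lamVecZ, if_pos rfl]
      refine ⟨fun d => ?_, fun j hj => ?_⟩
      · simpa [sgn, hnot] using pExpr_single_add_nonpos hp.pos (hgap i) (hnot i) d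
      · have : j ≠ rr (i - 1) := fun e => hnot _ (e ▸ hj)
        have : j ≠ rr i := fun e => hnot _ (e ▸ hj)
        simp [*]
    · rw [lamVecZ, if_neg hne]
      have hkR := hmem i k hk.1 (by omega)
      refine ⟨fun d => ?_, fun j _ => ?_⟩
      · simpa [sgn, hkR] using
          pExpr_single_add_nonpos hp.pos (sub_add_cancel (rr i) (k : ZMod n)) (hnot i) d
      · have hsingle (a : ZMod n) : (0 : ℤ) ≤ (Pi.single a 1 : ZMod n → ℤ) j := by
          rw [Pi.single_apply]
          split_ifs <;> norm_num
        exact add_nonneg (hsingle _) (mul_nonneg (by positivity) (hsingle _))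
  · have hq : (p : ℚ) ≠ 0 := by exact_mod_cast hp.ne_zero
    have hpn : (1 : ℚ) - (p : ℚ) ^ n < 0 :=
      sub_neg.2 (one_lt_pow₀ (by exact_mod_cast hp.one_lt) (NeZero.ne n))
    set C : ZMod n → ℚ := fun d => (pExpr p R d x : ℚ) / (1 - (p : ℚ) ^ n) with hCdef
    have hC0 : ∀ d, 0 ≤ C d := fun d =>
      div_nonneg_of_nonpos (by exact_mod_cast hx.1 d) hpn.le
    have hC : ∀ d, C d = sgn R d * x d + p * C (d + 1) := by
      intro d
      have := hpn.ne
      simp only [hCdef]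
      rw [pExpr_eq_add_succ p R d x]
      push_cast
      field_simp
    have hCR : ∀ d ∈ R, C d = -x d + p * C (d + 1) := by
      intro d hd
      rw [hC d, sgn, if_pos hd]
      push_cast
      ring
    refine ⟨fun i k => if k = g i then C (rr (i - 1) + 1) / (p : ℚ) ^ (g i - 1)
      else if 1 ≤ k ∧ k < g i then (x (rr i - k) : ℚ) / (p : ℚ) ^ k else 0, fun i k => ?_, ?_⟩
    · dsimp only
      split_ifs with h1 h2
      · exact div_nonneg (hC0 _) (by positivity)
      · exact div_nonneg (by exact_mod_cast hx.2 _ (hmem i k h2.1 h2.2)) (by positivity)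
      · exact le_rfl
    let e : ZMod n → ZMod n → ℚ := fun j => Pi.single j 1
    have hblock : ∀ i, ∑ k ∈ Finset.Icc 1 (g i),
        (if k = g i then C (rr (i - 1) + 1) / (p : ℚ) ^ (g i - 1)
          else if 1 ≤ k ∧ k < g i then (x (rr i - k) : ℚ) / (p : ℚ) ^ k else 0) •
          lamVecQ p rr g i k
        = ∑ k ∈ Finset.range (g i), (x (rr i - (k : ZMod n)) : ℚ) • e (rr i - (k : ZMod n))
          + (p * C (rr i + 1)) • e (rr i) - (p * C (rr (i - 1) + 1)) • e (rr (i - 1)) := by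
      intro i
      obtain ⟨m, hm⟩ : ∃ m, g i = m + 1 := ⟨g i - 1, by have := hg1 i; omega⟩
      have hstart : rr i - (m : ZMod n) = rr (i - 1) + 1 := by
        rw [← hgap i, hm]
        push_cast
        ring
      have htel := sum_div_pow_telescope hq (x := fun j => (x j : ℚ)) (C := C) (a := rr i) m
        fun k h1 h2 => hCR _ (hmem i k h1 (by omega))
      rw [hstart, hC (rr i), sgn, if_neg (hnot i)] at htel
      have hIcc : Finset.Icc 1 (m + 1) = Finset.Ico (0 + 1) (m + 1 + 1) := rfl
      rw [hm, hIcc, ← Finset.sum_Ico_add', ← Finset.range_eq_Ico, Finset.sum_range_succ,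
        Finset.sum_range_succ']
      have hterm : ∀ k ∈ Finset.range m,
          (if k + 1 = m + 1 then C (rr (i - 1) + 1) / (p : ℚ) ^ (m + 1 - 1)
            else if 1 ≤ k + 1 ∧ k + 1 < m + 1 then
              (x (rr i - ((k + 1 : ℕ) : ZMod n)) : ℚ) / (p : ℚ) ^ (k + 1) else 0) •
            lamVecQ p rr g i (k + 1)
          = ((x (rr i - ((k + 1 : ℕ) : ZMod n)) : ℚ) / (p : ℚ) ^ (k + 1)) • e (rr i)
            + (x (rr i - ((k + 1 : ℕ) : ZMod n)) : ℚ) • e (rr i - ((k + 1 : ℕ) : ZMod n)) := by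
        intro k hk
        rw [Finset.mem_range] at hk
        rw [lamVecQ, hm, if_neg (show k + 1 ≠ m + 1 by omega), if_neg (show k + 1 ≠ m + 1 by omega),
          if_pos (show 1 ≤ k + 1 ∧ k + 1 < m + 1 by omega), smul_add,
          smul_smul, div_mul_cancel₀ _ (pow_ne_zero _ hq)]
      rw [Finset.sum_congr rfl hterm, Finset.sum_add_distrib, ← Finset.sum_smul,
        eq_sub_of_add_eq htel, lamVecQ, hm, if_pos rfl, if_pos rfl, smul_sub, smul_smul,
        Nat.add_sub_cancel, Nat.cast_zero, sub_zero, show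
          C (rr (i - 1) + 1) / (p : ℚ) ^ m * (p : ℚ) ^ (m + 1) = p * C (rr (i - 1) + 1) by
          field_simp
          ring]
      push_cast
      module
    have hcyc : ∑ i, (p * C (rr (i - 1) + 1)) • e (rr (i - 1))
        = ∑ i, (p * C (rr i + 1)) • e (rr i) :=
      (Equiv.subRight (1 : Fin h)).sum_comp fun i => (p * C (rr i + 1)) • e (rr i)
    rw [Finset.sum_congr rfl fun i _ => hblock i, Finset.sum_sub_distrib,
      Finset.sum_add_distrib,
      sum_blocks hinj hrr hg1 hgap hmem fun j => (x j : ℚ) • e j,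
      hcyc, add_sub_cancel_right]
    funext j
    simp [e, Finset.sum_apply, Pi.single_apply]
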